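/- Let Π be a finite poset and let q_1,…,q_n be an enumeration of the non-minimal elements of Π such that i < j whenever q_j ≺ q_i. For each non-minimal q set w_q := −e_q, F_q := conv({−e_{q'} : q' is covered by q}), and φ_q := φ_{w_q,F_q}. Then for every k ∈ {0,1,…,n}, the partial composition φ_{q_k} ∘ ⋯ ∘ φ_{q_1} maps every vertex of the order polytope O(Π) to a vector in {0,1}^Π, and the image (φ_{q_k} ∘ ⋯ ∘ φ_{q_1})(O(Π)) is a convex set (indeed the convex hull of the images of the vertices of O(Π)). -/

import Mathlib

open Set Pointwise

/-- The standard pairing `⟨v,u⟩ = ∑ i, v i * u i` on `ι → ℝ`. -/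
noncomputable def dotProd {ι : Type*} [Fintype ι] (v u : ι → ℝ) : ℝ := ∑ i, v i * u i

/-- The hyperplane `H_{v,h} = {u : ⟨v,u⟩ = h}`. -/
def hyperplane {ι : Type*} [Fintype ι] (v : ι → ℝ) (h : ℝ) : Set (ι → ℝ) :=
  {u | dotProd v u = h}

/-- The halfspace `H_{v,≥k} = {u : ⟨v,u⟩ ≥ k}`. -/
def halfspaceGe {ι : Type*} [Fintype ι] (v : ι → ℝ) (k : ℝ) : Set (ι → ℝ) :=
  {u | k ≤ dotProd v u}

/-- The polar dual `P* = {v : ⟨v,u⟩ ≥ -1 for all u ∈ P}`. -/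
def polarDual {ι : Type*} [Fintype ι] (P : Set (ι → ℝ)) : Set (ι → ℝ) :=
  {v | ∀ u ∈ P, -1 ≤ dotProd v u}

/-- Cast an integer vector to a real vector. -/
def castZ {ι : Type*} (w : ι → ℤ) : ι → ℝ := fun i => (w i : ℝ)

/-- A nonzero integer vector is primitive if the gcd of its coordinates is 1. -/
def IsPrimitiveVec {ι : Type*} [Fintype ι] (w : ι → ℤ) : Prop :=
  Finset.gcd Finset.univ w = 1

/-- The set of lattice points of `ι → ℝ`. -/
def latticePts (ι : Type*) : Set (ι → ℝ) := Set.range castZ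

/-- A lattice polytope: convex hull of a finite nonempty set of lattice points. -/
def IsLatticePolytope {ι : Type*} [Fintype ι] (P : Set (ι → ℝ)) : Prop :=
  ∃ S : Finset (ι → ℤ), S.Nonempty ∧ P = convexHull ℝ (castZ '' (S : Set (ι → ℤ)))

/-- A rational polytope: some positive integer dilate is a lattice polytope. -/
def IsRationalPolytope {ι : Type*} [Fintype ι] (P : Set (ι → ℝ)) : Prop :=
  ∃ n : ℕ, 0 < n ∧ IsLatticePolytope ((n : ℝ) • P)

/-- The cone of all nonnegative linear combinations of a finite family of vectors. -/
def coneOf {ι : Type*} [Fintype ι] {κ : Type*} [Fintype κ] (v : κ → ι → ℝ) :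
    Set (ι → ℝ) :=
  {x | ∃ c : κ → ℝ, (∀ i, 0 ≤ c i) ∧ x = ∑ i, c i • v i}

/-- The cone of all nonnegative linear combinations of elements of a set. -/
def coneHull {ι : Type*} [Fintype ι] (S : Set (ι → ℝ)) : Set (ι → ℝ) :=
  {x | ∃ (n : ℕ) (c : Fin n → ℝ) (u : Fin n → ι → ℝ),
    (∀ i, 0 ≤ c i) ∧ (∀ i, u i ∈ S) ∧ x = ∑ i, c i • u i}

/-- `v` is a minimal generating set for the cone it generates. -/
def IsMinimalGen {ι : Type*} [Fintype ι] {κ : Type*} [Fintype κ] [DecidableEq κ]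
    (v : κ → ι → ℝ) : Prop :=
  ∀ i : κ, v i ∉ coneOf (fun j : {j : κ // j ≠ i} => v j.1)

/-- The mutation condition for `(P,w,F)` with the family `{G_h}_{h ≤ 0}`:
`V(P) ∩ H_{w,h} ⊆ G_h + (−h)F ⊆ P ∩ H_{w,h}` for all `h ≤ 0`. -/
def MutCond {ι : Type*} [Fintype ι] (P : Set (ι → ℝ)) (w : ι → ℝ) (F : Set (ι → ℝ))
    (G : ℝ → Set (ι → ℝ)) : Prop :=
  ∀ h : ℝ, h ≤ 0 →
    (P.extremePoints ℝ) ∩ hyperplane w h ⊆ G h + (-h) • F ∧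
    G h + (-h) • F ⊆ P ∩ hyperplane w h

/-- The combinatorial mutation `mut_w(P,F;{G_h})` of a rational polytope. -/
def mutPoly {ι : Type*} [Fintype ι] (w : ι → ℝ) (F : Set (ι → ℝ)) (P : Set (ι → ℝ))
    (G : ℝ → Set (ι → ℝ)) : Set (ι → ℝ) :=
  convexHull ℝ ((⋃ h ∈ Set.Iic (0 : ℝ), G h) ∪ ⋃ h ∈ Set.Ici (0 : ℝ), (P ∩ hyperplane w h + h • F))

/-- The combinatorial mutation `mut_w(C,F;{G_h})` of a cone. -/
def mutCone {ι : Type*} [Fintype ι] (w : ι → ℝ) (F : Set (ι → ℝ)) (C : Set (ι → ℝ))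
    (G : ℝ → Set (ι → ℝ)) : Set (ι → ℝ) :=
  coneHull ((⋃ h ∈ Set.Iic (0 : ℝ), G h) ∪ ⋃ h ∈ Set.Ici (0 : ℝ), (C ∩ hyperplane w h + h • F))

/-- `C` is a rational polyhedral pointed cone: generated by finitely many primitive lattice
points forming a minimal generating set, and containing no line. -/
def IsRatPointedCone {ι : Type*} [Fintype ι] (C : Set (ι → ℝ)) : Prop :=
  ∃ (m : ℕ) (v : Fin m → ι → ℤ),
    (∀ i, IsPrimitiveVec (v i)) ∧
    IsMinimalGen (fun i => castZ (v i)) ∧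
    C = coneOf (fun i => castZ (v i)) ∧
    C ∩ (-C) = {0}

/-- The piecewise-linear map `φ_{w,F}(u) = u − u_min · w`, `u_min = min{⟨u,v⟩ : v ∈ F}`. -/
noncomputable def phiMut {ι : Type*} [Fintype ι] (w : ι → ℝ) (F : Set (ι → ℝ))
    (u : ι → ℝ) : ι → ℝ :=
  u - sInf ((fun v => dotProd u v) '' F) • w

/-- The recession cone of a set. -/
def recessionCone {ι : Type*} [Fintype ι] (A : Set (ι → ℝ)) : Set (ι → ℝ) :=
  {y | ∀ x ∈ A, ∀ t : ℝ, 0 ≤ t → x + t • y ∈ A}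
/-- The width vector `w_q = -e_q` for an element `q` of a finite poset. -/
def posetW {P : Type*} [DecidableEq P] (q : P) : P → ℝ := -(Pi.single q 1)

/-- The factor `F_q = conv{-e_{q'} : q' is covered by q}`. -/
def posetF (P : Type*) [Fintype P] [DecidableEq P] [PartialOrder P] (q : P) :
    Set (P → ℝ) :=
  convexHull ℝ {y : P → ℝ | ∃ q', q' ⋖ q ∧ y = -(Pi.single q' 1)}

/-- The piecewise-linear map `φ_q := φ_{w_q, F_q}`. -/
noncomputable def posetPhi {P : Type*} [Fintype P] [DecidableEq P] [PartialOrder P]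
    (q : P) : (P → ℝ) → (P → ℝ) :=
  phiMut (posetW q) (posetF P q)
/-- The order polytope of a finite poset. -/
def orderPolytope (P : Type*) [Fintype P] [PartialOrder P] : Set (P → ℝ) :=
  {x | (∀ p, 0 ≤ x p ∧ x p ≤ 1) ∧ ∀ p q : P, p ≤ q → x p ≤ x q}

/-- The chain polytope of a finite poset. -/
def chainPolytope (P : Type*) [Fintype P] [PartialOrder P] : Set (P → ℝ) :=
  {x | (∀ p, 0 ≤ x p) ∧ ∀ l : List P, l.Chain' (· < ·) → (l.map x).sum ≤ 1}
/-- Lower covers of an element. -/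
noncomputable def lcov {P : Type*} [Fintype P] [PartialOrder P] (p : P) : Finset P := by
  classical exact Finset.univ.filter (fun a => a ⋖ p)

lemma mem_lcov {P : Type*} [Fintype P] [PartialOrder P] {p a : P} : a ∈ lcov p ↔ a ⋖ p := by
  classical
  simp [lcov]

lemma lcov_nonempty {P : Type*} [Fintype P] [PartialOrder P] {p : P} (h : ¬ IsMin p) :
    (lcov p).Nonempty := by
  rw [not_isMin_iff] at h
  obtain ⟨b, hb⟩ := h
  classical
  obtain ⟨m, hm, hmax⟩ := (Finset.univ.filter (fun a => a < p)).exists_maximal ⟨b, by simpa using hb⟩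
  refine ⟨m, mem_lcov.2 ⟨by simpa using hm, fun c hmc hcp => ?_⟩⟩
  exact absurd (hmax (by simpa using hcp) hmc.le) (not_le_of_gt hmc)

/-- Maximum over lower covers. -/
noncomputable def lmax {P : Type*} [Fintype P] [PartialOrder P] (p : P) (x : P → ℝ) : ℝ := by
  classical exact if h : (lcov p).Nonempty then (lcov p).sup' h x else 0

section
variable {P : Type*} [Fintype P] [PartialOrder P]

lemma lmax_exists {p : P} (h : ¬ IsMin p) (x : P → ℝ) : ∃ a, a ⋖ p ∧ lmax p x = x a := by
  have h' := lcov_nonempty h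
  obtain ⟨a, ha, he⟩ := Finset.exists_mem_eq_sup' h' x
  exact ⟨a, mem_lcov.1 ha, by simp [lmax, h', he]⟩

lemma le_lmax {p a : P} (h : a ⋖ p) (x : P → ℝ) : x a ≤ lmax p x := by
  have h' : (lcov p).Nonempty := ⟨a, mem_lcov.2 h⟩
  simp only [lmax, h', dif_pos]
  exact Finset.le_sup' x (mem_lcov.2 h)

lemma lmax_eq {p a : P} (h : a ⋖ p) (x : P → ℝ) (hx : ∀ b, b ⋖ p → x b ≤ x a) :
    lmax p x = x a := by
  obtain ⟨b, hb, he⟩ := lmax_exists (fun hm => hm.not_lt h.lt) x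
  exact le_antisymm (he ▸ hx b hb) (le_lmax h x)

lemma lmax_congr {p : P} {x y : P → ℝ} (h : ∀ b, b ⋖ p → x b = y b) : lmax p x = lmax p y := by
  by_cases h' : (lcov p).Nonempty
  · simp only [lmax, h', dif_pos]
    exact Finset.sup'_congr h' rfl (fun b hb => h b (mem_lcov.1 hb))
  · simp [lmax, h']

lemma continuous_lmax (p : P) : Continuous (lmax p : (P → ℝ) → ℝ) := by
  by_cases h' : (lcov p).Nonempty
  · have e : (lmax p : (P → ℝ) → ℝ) = fun x => (lcov p).sup' h' x := by
      funext x
      simp [lmax, h']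
    rw [e]
    exact Continuous.finset_sup'_apply h' (fun i _ => continuous_apply i)
  · have e : (lmax p : (P → ℝ) → ℝ) = fun x => 0 := by
      funext x
      simp [lmax, h']
    rw [e]
    exact continuous_const

/-- The transfer map for a set `S`. -/
noncomputable def tmap (S : Set P) (x : P → ℝ) : P → ℝ := by
  classical exact fun p => if p ∈ S then x p - lmax p x else x p

lemma tmap_mem {S : Set P} {p : P} (h : p ∈ S) (x : P → ℝ) : tmap S x p = x p - lmax p x := by
  simp [tmap, h]

lemma tmap_not_mem {S : Set P} {p : P} (h : p ∉ S) (x : P → ℝ) : tmap S x p = x p := by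
  simp [tmap, h]

lemma continuous_tmap (S : Set P) : Continuous (tmap S) := by
  refine continuous_pi fun p => ?_
  by_cases h : p ∈ S
  · simp only [tmap_mem h]
    exact (continuous_apply p).sub (continuous_lmax p)
  · simp only [tmap_not_mem h]
    exact continuous_apply p

lemma tmap_inj (S : Set P) : Function.Injective (tmap S) := by
  intro x y hxy
  funext p
  induction p using (wellFounded_lt (α := P)).induction with
  | _ p ih =>
    have h := congrFun hxy p
    by_cases hp : p ∈ S
    · rw [tmap_mem hp, tmap_mem hp, lmax_congr (fun b hb => ih b hb.lt)] at h
      linarith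
    · rwa [tmap_not_mem hp, tmap_not_mem hp] at h

lemma tmap_surj (S : Set P) (y : P → ℝ) : ∃ x, tmap S x = y := by
  classical
  let H : ∀ p : P, (∀ b, b < p → ℝ) → ℝ := fun p f =>
    y p + if p ∈ S then lmax p (fun b => if h : b < p then f b h else 0) else 0
  refine ⟨(wellFounded_lt (α := P)).fix H, ?_⟩
  funext p
  set x := (wellFounded_lt (α := P)).fix H with hx
  have e : x p = y p + if p ∈ S then lmax p x else 0 := by
    rw [hx, WellFounded.fix_eq]
    simp only [H]
    congr 2
    apply lmax_congr
    intro b hb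
    simp [hb.lt]
  by_cases hp : p ∈ S
  · rw [tmap_mem hp, e]; simp [hp]
  · rw [tmap_not_mem hp, e]; simp [hp]

lemma sq_mem {x : P → ℝ} (hx : x ∈ orderPolytope P) : (fun p => x p ^ 2) ∈ orderPolytope P := by
  refine ⟨fun p => ⟨sq_nonneg _, ?_⟩, fun p q hpq => ?_⟩
  · have := hx.1 p; nlinarith
  · have := hx.1 p; have := hx.2 p q hpq; dsimp; nlinarith

lemma sq_mem' {x : P → ℝ} (hx : x ∈ orderPolytope P) :
    (fun p => 2 * x p - x p ^ 2) ∈ orderPolytope P := by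
  refine ⟨fun p => ⟨?_, ?_⟩, fun p q hpq => ?_⟩
  · have := hx.1 p; nlinarith
  · have := hx.1 p; nlinarith [sq_nonneg (1 - x p)]
  · have := hx.1 p; have := hx.1 q; have := hx.2 p q hpq; dsimp; nlinarith

lemma tmap_mid (S : Set P) (hS : ∀ p ∈ S, ¬ IsMin p) {x : P → ℝ} (hx : x ∈ orderPolytope P) :
    tmap S x = (1 / 2 : ℝ) • tmap S (fun p => x p ^ 2) +
      (1 / 2 : ℝ) • tmap S (fun p => 2 * x p - x p ^ 2) := by
  funext p
  simp only [Pi.add_apply, Pi.smul_apply, smul_eq_mul]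
  by_cases hp : p ∈ S
  · obtain ⟨a, ha, he⟩ := lmax_exists (hS p hp) x
    have hle : ∀ b, b ⋖ p → x b ≤ x a := fun b hb => he ▸ le_lmax hb x
    rw [tmap_mem hp, tmap_mem hp, tmap_mem hp, he,
      lmax_eq ha (fun p => x p ^ 2) (fun b hb => by
        have := hx.1 b; have := hle b hb; nlinarith),
      lmax_eq ha (fun p => 2 * x p - x p ^ 2) (fun b hb => by
        have := hx.1 b; have := hx.1 a; have := hle b hb; nlinarith)]
    ring
  · rw [tmap_not_mem hp, tmap_not_mem hp, tmap_not_mem hp]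
    ring

lemma zero_one_of_ext (S : Set P) (hS : ∀ p ∈ S, ¬ IsMin p) {x : P → ℝ}
    (hx : x ∈ orderPolytope P) (hext : tmap S x ∈ (tmap S '' orderPolytope P).extremePoints ℝ)
    (p : P) : x p = 0 ∨ x p = 1 := by
  have h := hext.2 (mem_image_of_mem _ (sq_mem hx)) (mem_image_of_mem _ (sq_mem' hx))
    ⟨1 / 2, 1 / 2, by norm_num, by norm_num, by norm_num, (tmap_mid S hS hx).symm⟩
  have h2 := congrFun (tmap_inj S h) p
  have : x p * (x p - 1) = 0 := by linarith
  rcases mul_eq_zero.1 this with h | h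
  · exact Or.inl h
  · exact Or.inr (by linarith)

lemma ext_of_zero_one {x : P → ℝ} (hx : x ∈ orderPolytope P) (h : ∀ p, x p = 0 ∨ x p = 1) :
    x ∈ (orderPolytope P).extremePoints ℝ := by
  refine ⟨hx, ?_⟩
  rintro u hu v hv ⟨a, b, ha, hb, hab, rfl⟩
  funext p
  have hp := h p
  simp only [Pi.add_apply, Pi.smul_apply, smul_eq_mul] at hp ⊢
  have h1 := hu.1 p
  have h2 := hv.1 p
  obtain rfl : b = 1 - a := by linarith
  rcases hp with hp | hp
  · rw [hp]
    have := mul_nonneg hb.le h2.1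
    have : a * u p ≤ 0 := by linarith
    nlinarith
  · rw [hp]
    have := mul_le_mul_of_nonneg_left h2.2 hb.le
    have : a * (1 - u p) ≤ 0 := by linarith
    nlinarith

lemma tmap_empty : tmap (∅ : Set P) = id := by
  funext x p
  simp [tmap]

lemma zero_one_of_vertex {x : P → ℝ} (hx : x ∈ (orderPolytope P).extremePoints ℝ) (p : P) :
    x p = 0 ∨ x p = 1 := by
  refine zero_one_of_ext ∅ (by simp) hx.1 ?_ p
  simpa [tmap_empty] using hx

lemma tmap_vertex (S : Set P) (hS : ∀ p ∈ S, ¬ IsMin p) {x : P → ℝ}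
    (hx : x ∈ (orderPolytope P).extremePoints ℝ) (p : P) :
    tmap S x p = 0 ∨ tmap S x p = 1 := by
  have h := zero_one_of_vertex hx
  by_cases hp : p ∈ S
  · obtain ⟨a, ha, he⟩ := lmax_exists (hS p hp) x
    rw [tmap_mem hp, he]
    have hle := hx.1.2 a p ha.le
    rcases h a with h1 | h1 <;> rcases h p with h2 | h2 <;> rw [h1, h2] at hle ⊢ <;> first | (left; linarith) | (right; linarith)
  · rw [tmap_not_mem hp]; exact h p

lemma mono_of_cov {x : P → ℝ} (h : ∀ a p : P, a ⋖ p → x a ≤ x p) : ∀ p q : P, p ≤ q → x p ≤ x q := by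
  intro p q
  induction q using (wellFounded_lt (α := P)).induction with
  | _ q ih =>
    intro hpq
    rcases hpq.eq_or_lt with rfl | hlt
    · exact le_rfl
    · classical
      obtain ⟨m, hm, hmax⟩ := (Finset.univ.filter (fun a => p ≤ a ∧ a < q)).exists_maximal
        ⟨p, by simpa using hlt⟩
      simp only [Finset.mem_filter, Finset.mem_univ, true_and] at hm hmax
      have hc : m ⋖ q := ⟨hm.2, fun c hmc hcq =>
        absurd (hmax ⟨hm.1.trans hmc.le, hcq⟩ hmc.le) (not_le_of_gt hmc)⟩
      exact (ih m hm.2 hm.1).trans (h m q hc)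

lemma tmap_convex (S : Set P) (hS : ∀ p ∈ S, ¬ IsMin p) (hup : IsUpperSet S) :
    Convex ℝ (tmap S '' orderPolytope P) := by
  rintro _ ⟨u, hu, rfl⟩ _ ⟨v, hv, rfl⟩ a b ha hb hab
  obtain ⟨x, hx⟩ := tmap_surj S (a • tmap S u + b • tmap S v)
  refine ⟨x, ?_, hx⟩
  have hx' := fun p => congrFun hx p
  simp only [Pi.add_apply, Pi.smul_apply, smul_eq_mul] at hx'
  have hout : ∀ p, p ∉ S → x p = a * u p + b * v p := by
    intro p hp
    have := hx' p
    rwa [tmap_not_mem hp, tmap_not_mem hp, tmap_not_mem hp] at this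
  have hin : ∀ p, p ∈ S → x p = lmax p x + (a * (u p - lmax p u) + b * (v p - lmax p v)) := by
    intro p hp
    have := hx' p
    rw [tmap_mem hp, tmap_mem hp, tmap_mem hp] at this
    linarith
  have hnn : ∀ w ∈ orderPolytope P, ∀ p ∈ S, 0 ≤ w p - lmax p w := by
    intro w hw p hp
    obtain ⟨c, hc, he⟩ := lmax_exists (hS p hp) w
    have := hw.2 c p hc.le
    linarith
  have hge : ∀ p ∈ S, lmax p x ≤ x p := by
    intro p hp
    have h1 := mul_nonneg ha (hnn u hu p hp)
    have h2 := mul_nonneg hb (hnn v hv p hp)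
    have := hin p hp
    linarith
  have hle : ∀ p, x p ≤ a * u p + b * v p := by
    intro p
    induction p using (wellFounded_lt (α := P)).induction with
    | _ p ih =>
      by_cases hp : p ∈ S
      · obtain ⟨c, hc, he⟩ := lmax_exists (hS p hp) x
        have h0 := ih c hc.lt
        have h1 := mul_le_mul_of_nonneg_left (le_lmax hc u) ha
        have h2 := mul_le_mul_of_nonneg_left (le_lmax hc v) hb
        have := hin p hp
        linarith
      · exact (hout p hp).le
  have hpos : ∀ p, 0 ≤ x p := by
    intro p
    induction p using (wellFounded_lt (α := P)).induction with
    | _ p ih =>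
      by_cases hp : p ∈ S
      · obtain ⟨c, hc, he⟩ := lmax_exists (hS p hp) x
        have h0 := ih c hc.lt
        have := hge p hp
        linarith
      · rw [hout p hp]
        have h1 := mul_nonneg ha (hu.1 p).1
        have h2 := mul_nonneg hb (hv.1 p).1
        linarith
  refine ⟨fun p => ⟨hpos p, ?_⟩, mono_of_cov ?_⟩
  · have h1 := mul_le_mul_of_nonneg_left (hu.1 p).2 ha
    have h2 := mul_le_mul_of_nonneg_left (hv.1 p).2 hb
    have := hle p
    linarith
  · intro c p hc
    by_cases hp : p ∈ S
    · exact (le_lmax hc x).trans (hge p hp)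
    · have hcS : c ∉ S := fun h => hp (hup hc.le h)
      rw [hout p hp, hout c hcS]
      have h1 := mul_le_mul_of_nonneg_left (hu.2 c p hc.le) ha
      have h2 := mul_le_mul_of_nonneg_left (hv.2 c p hc.le) hb
      linarith

lemma isCompact_orderPolytope : IsCompact (orderPolytope P) := by
  have hc : IsCompact (Set.pi Set.univ (fun _ : P => Set.Icc (0 : ℝ) 1)) :=
    isCompact_univ_pi fun _ => isCompact_Icc
  have hcl : IsClosed {x : P → ℝ | ∀ p q : P, p ≤ q → x p ≤ x q} := by
    simp only [Set.ofPred_forall]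
    exact isClosed_iInter fun p => isClosed_iInter fun q => isClosed_iInter fun _ =>
      isClosed_le (continuous_apply p) (continuous_apply q)
  convert hc.inter_right hcl using 1
  ext x
  constructor
  · intro h
    exact ⟨fun p _ => h.1 p, h.2⟩
  · intro h
    exact ⟨fun p => h.1 p trivial, h.2⟩

lemma tmap_hull (S : Set P) (hS : ∀ p ∈ S, ¬ IsMin p) (hup : IsUpperSet S) :
    tmap S '' orderPolytope P = convexHull ℝ (tmap S '' (orderPolytope P).extremePoints ℝ) := by
  have hconv := tmap_convex S hS hup
  have hcomp : IsCompact (tmap S '' orderPolytope P) :=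
    isCompact_orderPolytope.image (continuous_tmap S)
  apply Subset.antisymm
  · have hfin : ((orderPolytope P).extremePoints ℝ).Finite := by
      refine Set.Finite.subset (Set.Finite.pi' (t := fun _ : P => ({0, 1} : Set ℝ))
        (fun _ => by simp)) ?_
      intro x hx p
      simpa using zero_one_of_vertex hx p
    have hclosed := ((hfin.image (tmap S)).isClosed_convexHull (𝕜 := ℝ))
    rw [← closure_convexHull_extremePoints hcomp hconv]
    refine closure_minimal (convexHull_mono ?_) hclosed
    intro y hy
    obtain ⟨x, hx, rfl⟩ := hy.1
    exact ⟨x, ext_of_zero_one hx (zero_one_of_ext S hS hx hy), rfl⟩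
  · exact convexHull_min (image_mono extremePoints_subset) hconv

end

lemma posetPhi_apply {P : Type*} [Fintype P] [DecidableEq P] [PartialOrder P] {q : P}
    (hq : ¬ IsMin q) (u : P → ℝ) (p : P) :
    posetPhi q u p = if p = q then u p - lmax q u else u p := by
  have hdot : ∀ a : P, dotProd u (-(Pi.single a 1)) = - u a := by
    intro a
    simp [dotProd, Pi.single_apply]
  have hlin : IsLinearMap ℝ (fun v : P → ℝ => dotProd u v) := by
    constructor
    · intro x y; simp [dotProd, mul_add, Finset.sum_add_distrib]
    · intro c x; simp only [dotProd, Pi.smul_apply, smul_eq_mul, Finset.mul_sum]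
      exact Finset.sum_congr rfl fun i _ => by ring
  have hs : sInf ((fun v => dotProd u v) '' posetF P q) = - lmax q u := by
    apply IsLeast.csInf_eq
    constructor
    · obtain ⟨a, ha, he⟩ := lmax_exists hq u
      exact ⟨-(Pi.single a 1), subset_convexHull ℝ _ ⟨a, ha, rfl⟩, by simp only [hdot, he]⟩
    · rintro _ ⟨v, hv, rfl⟩
      have : posetF P q ⊆ {v | - lmax q u ≤ dotProd u v} := by
        refine convexHull_min ?_ (convex_halfSpace_ge hlin _)
        rintro _ ⟨a, ha, rfl⟩
        simp only [Set.mem_ofPred_eq, hdot]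
        have := le_lmax ha u
        linarith
      exact this hv
  rw [posetPhi, phiMut, hs]
  by_cases h : p = q
  · subst h; simp [posetW]
  · simp [posetW, h]

lemma foldl_eq {P : Type*} [Fintype P] [DecidableEq P] [PartialOrder P] (l : List P)
    (hmin : ∀ p ∈ l, ¬ IsMin p) (hpw : l.Pairwise (fun a b => a ≠ b ∧ ¬ a < b)) (x : P → ℝ) :
    l.foldl (fun y p' => posetPhi p' y) x = tmap {p | p ∈ l} x := by
  induction l using List.reverseRecOn with
  | nil => funext p; simp [tmap]
  | append_singleton l q ih =>
    rw [List.pairwise_append] at hpw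
    obtain ⟨h1, -, h2⟩ := hpw
    have ih' := ih (fun p hp => hmin p (by simp [hp])) h1
    have hq := hmin q (by simp)
    rw [List.foldl_append, ih']
    simp only [List.foldl_cons, List.foldl_nil]
    funext p
    rw [posetPhi_apply hq]
    have hql : q ∉ l := fun h => (h2 q h q (by simp)).1 rfl
    by_cases hp : p = q
    · subst hp
      rw [if_pos rfl, tmap_not_mem (S := {p | p ∈ l}) hql, tmap_mem (by simp)]
      congr 1
      apply lmax_congr
      intro b hb
      exact tmap_not_mem (S := {p | p ∈ l}) (fun h => (h2 b h p (by simp)).2 hb.lt) x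
    · rw [if_neg hp]
      by_cases hpl : p ∈ l
      · rw [tmap_mem (by simpa using hpl), tmap_mem (by simp [hpl])]
      · rw [tmap_not_mem (by simpa using hpl), tmap_not_mem (by simp [hpl, hp])]

/-- Each partial composition `φ_{q_k} ∘ ⋯ ∘ φ_{q_1}` maps every vertex of
the order polytope to a `(0,1)`-vector, and the image of the order polytope is convex
(indeed the convex hull of the images of the vertices). -/
theorem stmt_17 {P : Type*} [Fintype P] [DecidableEq P] [PartialOrder P]
    {n : ℕ} (q : Fin n → P) (hinj : Function.Injective q)
    (hrange : Set.range q = {p : P | ¬ IsMin p})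
    (horder : ∀ i j, q j < q i → i < j) :
    ∀ k : ℕ, k ≤ n →
      (∀ x ∈ (orderPolytope P).extremePoints ℝ, ∀ p : P,
          ((List.ofFn q).take k).foldl (fun y p' => posetPhi p' y) x p = 0 ∨
          ((List.ofFn q).take k).foldl (fun y p' => posetPhi p' y) x p = 1) ∧
      Convex ℝ ((fun x : P → ℝ => ((List.ofFn q).take k).foldl (fun y p' => posetPhi p' y) x) ''
        orderPolytope P) ∧
      (fun x : P → ℝ => ((List.ofFn q).take k).foldl (fun y p' => posetPhi p' y) x) ''
          orderPolytope P =
        convexHull ℝ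
          ((fun x : P → ℝ => ((List.ofFn q).take k).foldl (fun y p' => posetPhi p' y) x) ''
            ((orderPolytope P).extremePoints ℝ)) := by
  intro k hk
  have hnm : ∀ i, ¬ IsMin (q i) := fun i => by
    have : q i ∈ Set.range q := ⟨i, rfl⟩
    rw [hrange] at this
    exact this
  have hmem : ∀ p, p ∈ (List.ofFn q).take k ↔ ∃ i : Fin n, (i : ℕ) < k ∧ q i = p := by
    intro p
    rw [List.mem_take_iff_getElem]
    constructor
    · rintro ⟨i, hi, rfl⟩
      simp only [List.length_ofFn, lt_min_iff] at hi
      exact ⟨⟨i, hi.2⟩, hi.1, by simp⟩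
    · rintro ⟨i, hi, rfl⟩
      exact ⟨i, by simp [hi], by simp⟩
  have hS : ∀ p ∈ {p | p ∈ (List.ofFn q).take k}, ¬ IsMin p := by
    intro p hp
    obtain ⟨i, -, rfl⟩ := (hmem p).1 hp
    exact hnm i
  have hup : IsUpperSet {p | p ∈ (List.ofFn q).take k} := by
    intro a b hab ha
    rcases hab.eq_or_lt with rfl | hlt
    · exact ha
    obtain ⟨i, hi, rfl⟩ := (hmem a).1 ha
    have hb : b ∈ Set.range q := by
      rw [hrange]
      exact fun hm => hm.not_lt hlt
    obtain ⟨j, rfl⟩ := hb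
    have hji : j < i := horder j i hlt
    exact (hmem _).2 ⟨j, lt_trans hji hi, rfl⟩
  have hpw : ((List.ofFn q).take k).Pairwise (fun a b => a ≠ b ∧ ¬ a < b) := by
    refine List.Pairwise.sublist (List.take_sublist _ _) ?_
    rw [List.pairwise_ofFn]
    intro i j hij
    exact ⟨fun h => hij.ne (hinj h), fun h => absurd (horder j i h) (not_lt_of_gt hij)⟩
  simp only [foldl_eq _ hS hpw]
  exact ⟨fun x hx p => tmap_vertex _ hS hx p, tmap_convex _ hS hup, tmap_hull _ hS hup⟩
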